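/- arXiv:1809.04367 — 3 statements merged into one kernel-verified Lean document; each statement's English description precedes it below -/
import Mathlib

section
/- Fix α > 0. There exists a constant C > 0 such that for all n ∈ ℕ (n ≥ 1), all x ∈ ℤ and all t ≥ 0: ∫₀ᵗ (e^{s n² 𝒜_n} 𝟙_{{0,1}})(x) ds ≤ C √t / n; that is, the expected amount of time spent in the set {0,1} up to time t by the continuous-time random walk with generator n²𝒜_n started at x is at most C√t/n. -/
open MeasureTheory Filter
open scoped BoundedContinuousFunction NNReal

/-- The exchange rate of the bond `{x, x+1}`: `α/n` at the slow bond `{0,1}`, else `1`. -/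
noncomputable def xi (α : ℝ) (n : ℕ) (x : ℤ) : ℝ := if x = 0 then α / n else 1

/-- The slow-bond generator `𝒜_n` acting pointwise on functions `f : ℤ → ℝ`. -/
noncomputable def slowGen (α : ℝ) (n : ℕ) (f : ℤ → ℝ) (x : ℤ) : ℝ :=
  xi α n x * (f (x + 1) - f x) + xi α n (x - 1) * (f (x - 1) - f x)

/-- The operator exponential `e^{tA}` of a bounded operator `A`, applied to `f`:
`e^{tA} f = ∑_k (t^k / k!) A^k f`. -/
noncomputable def expApply {E : Type*} [NormedAddCommGroup E] [NormedSpace ℝ E]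
    (A : E →L[ℝ] E) (t : ℝ) (f : E) : E :=
  ∑' k : ℕ, (t ^ k / (k.factorial : ℝ)) • ((A ^ k) f)

section
variable {E : Type*} [NormedAddCommGroup E] [NormedSpace ℝ E] [CompleteSpace E]

/-- The operator exponential as a bounded operator. -/
noncomputable def opExp {E : Type*} [NormedAddCommGroup E] [NormedSpace ℝ E]
    (A : E →L[ℝ] E) (t : ℝ) : E →L[ℝ] E := NormedSpace.exp (t • A)

lemma expApply_eq (A : E →L[ℝ] E) (t : ℝ) (f : E) :
    HasSum (fun k : ℕ => (t ^ k / (k.factorial : ℝ)) • ((A ^ k) f)) (opExp A t f) := by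
  have h := NormedSpace.exp_series_hasSum_exp' (𝕂 := ℝ) (t • A)
  have h2 := h.mapL (ContinuousLinearMap.apply ℝ E f)
  convert h2 using 2 with k
  · simp [smul_pow, smul_smul, div_eq_inv_mul]
  · rfl

lemma opExp_shift (A : E →L[ℝ] E) (M t : ℝ) (f : E) :
    opExp A t f = Real.exp (-(t * M)) • opExp (A + M • ContinuousLinearMap.id ℝ E) t f := by
  let _ : NormedAlgebra ℚ (E →L[ℝ] E) := NormedAlgebra.restrictScalars ℚ ℝ _
  have e : t • A = algebraMap ℝ _ (-(t * M)) + t • (A + M • ContinuousLinearMap.id ℝ E) := by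
    rw [Algebra.algebraMap_eq_smul_one, ContinuousLinearMap.one_def]
    module
  have hc : Commute (algebraMap ℝ (E →L[ℝ] E) (-(t * M)))
      (t • (A + M • ContinuousLinearMap.id ℝ E)) := Algebra.commutes _ _
  unfold opExp
  rw [e, NormedSpace.exp_add_of_commute hc, ← NormedSpace.algebraMap_exp_comm,
    Algebra.algebraMap_eq_smul_one, ← Real.exp_eq_exp_ℝ]
  simp

lemma opExp_deriv (A : E →L[ℝ] E) (g : E) (l : E →L[ℝ] ℝ) (c s : ℝ) :
    HasDerivAt (fun s : ℝ => l (opExp A (s * c) g)) (l (opExp A (s * c) (A g)) * c) s := by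
  have h1 := hasDerivAt_exp_smul_const (𝕂 := ℝ) A (s * c)
  have h2 := (l.comp (ContinuousLinearMap.apply ℝ E g)).hasFDerivAt.comp_hasDerivAt _ h1
  have h3 : HasDerivAt (fun s : ℝ => s * c) c s := by
    simpa using (hasDerivAt_id s).mul_const c
  exact h2.comp s h3

lemma opExp_zero (A : E →L[ℝ] E) (f : E) : opExp A 0 f = f := by
  simp [opExp]

end

lemma exp_one_apply (A : (ℤ →ᵇ ℝ) →L[ℝ] (ℤ →ᵇ ℝ)) (t : ℝ) (f : ℤ →ᵇ ℝ) (hf : A f = 0) :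
    opExp A t f = f := by
  have h := expApply_eq A t f
  refine h.unique ?_
  have := hasSum_single (f := fun k : ℕ => (t ^ k / (k.factorial : ℝ)) • ((A ^ k) f)) 0 (by
    intro k hk
    obtain ⟨j, rfl⟩ := Nat.exists_eq_succ_of_ne_zero hk
    simp [pow_succ, hf])
  simpa using this

lemma exp_pos_of_pos (B : (ℤ →ᵇ ℝ) →L[ℝ] (ℤ →ᵇ ℝ))
    (hB : ∀ f : ℤ →ᵇ ℝ, (∀ x, 0 ≤ f x) → ∀ x, 0 ≤ B f x)
    (t : ℝ) (ht : 0 ≤ t) (f : ℤ →ᵇ ℝ) (hf : ∀ x, 0 ≤ f x) (x : ℤ) :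
    0 ≤ opExp B t f x := by
  have h := (expApply_eq B t f).mapL (BoundedContinuousFunction.evalCLM ℝ x)
  have hk : ∀ k : ℕ, ∀ x, 0 ≤ (B ^ k) f x := by
    intro k
    induction k with
    | zero => simpa using hf
    | succ k ih =>
      intro x
      rw [pow_succ']
      exact hB _ ih x
  refine h.nonneg ?_
  intro k
  have := hk k x
  simp only [map_smul, BoundedContinuousFunction.evalCLM_apply, smul_eq_mul]
  positivity

lemma exp_pos_shift (A : (ℤ →ᵇ ℝ) →L[ℝ] (ℤ →ᵇ ℝ)) (M : ℝ)
    (hA : ∀ f : ℤ →ᵇ ℝ, (∀ x, 0 ≤ f x) → ∀ x, 0 ≤ A f x + M * f x)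
    (t : ℝ) (ht : 0 ≤ t) (f : ℤ →ᵇ ℝ) (hf : ∀ x, 0 ≤ f x) (x : ℤ) :
    0 ≤ opExp A t f x := by
  rw [opExp_shift A M]
  have := exp_pos_of_pos (A + M • ContinuousLinearMap.id ℝ _) (by
    intro f hf x
    have := hA f hf x
    simpa using this) t ht f hf x
  rw [BoundedContinuousFunction.smul_apply, smul_eq_mul]
  exact mul_nonneg (Real.exp_pos _).le this

/-- The Lyapunov function `K r^{h(x)}`, `h` the distance to `{0,1}`. -/
noncomputable def lyap (K r : ℝ) (x : ℤ) : ℝ :=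
  K * r ^ (if x ≤ 0 then (-x).toNat else (x - 1).toNat)

lemma lyap_neg (K r : ℝ) (k : ℕ) : lyap K r (-(k : ℤ)) = K * r ^ k := by
  simp [lyap]

lemma lyap_pos (K r : ℝ) (k : ℕ) : lyap K r ((k : ℤ) + 1) = K * r ^ k := by
  have : ¬ ((k : ℤ) + 1 ≤ 0) := by omega
  simp [lyap, this]

lemma lyap_gen (α : ℝ) (n : ℕ) (m : ℝ) (hm : 0 < m) (x : ℤ) :
    slowGen α n (lyap m⁻¹ (1 + m)⁻¹) x ≤
      m ^ 2 * lyap m⁻¹ (1 + m)⁻¹ x - (if x = 0 ∨ x = 1 then 1 else 0) := by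
  have key0 : m⁻¹ * (1 + m)⁻¹ - m⁻¹ ≤ m ^ 2 * m⁻¹ - 1 := by
    have : m ^ 2 * m⁻¹ - 1 - (m⁻¹ * (1 + m)⁻¹ - m⁻¹) = m ^ 2 / (1 + m) := by
      field_simp; ring
    have : 0 ≤ m ^ 2 / (1 + m) := by positivity
    linarith
  have key : ∀ k : ℕ, (m⁻¹ * (1 + m)⁻¹ ^ (k + 2) - m⁻¹ * (1 + m)⁻¹ ^ (k + 1)) +
      (m⁻¹ * (1 + m)⁻¹ ^ k - m⁻¹ * (1 + m)⁻¹ ^ (k + 1)) ≤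
      m ^ 2 * (m⁻¹ * (1 + m)⁻¹ ^ (k + 1)) := by
    intro k
    have h1 : 0 ≤ m⁻¹ * (1 + m)⁻¹ ^ k := by positivity
    have h2 : (1 + m)⁻¹ ^ 2 - 2 * (1 + m)⁻¹ + 1 ≤ m ^ 2 * (1 + m)⁻¹ := by
      have : m ^ 2 * (1 + m)⁻¹ - ((1 + m)⁻¹ ^ 2 - 2 * (1 + m)⁻¹ + 1) = m ^ 3 / (1 + m) ^ 2 := by
        field_simp; ring
      have : 0 ≤ m ^ 3 / (1 + m) ^ 2 := by positivity
      linarith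
    have := mul_le_mul_of_nonneg_left h2 h1
    ring_nf at this ⊢
    linarith
  have hcase : x = 0 ∨ x = 1 ∨ (∃ k : ℕ, x = -((k : ℤ) + 1)) ∨ (∃ k : ℕ, x = (k : ℤ) + 2) := by
    rcases lt_trichotomy x 0 with h | h | h
    · exact Or.inr (Or.inr (Or.inl ⟨(-x - 1).toNat, by omega⟩))
    · exact Or.inl h
    · by_cases h1 : x = 1
      · exact Or.inr (Or.inl h1)
      · exact Or.inr (Or.inr (Or.inr ⟨(x - 2).toNat, by omega⟩))
  rcases hcase with rfl | rfl | ⟨k, rfl⟩ | ⟨k, rfl⟩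
  · have e0 := lyap_neg m⁻¹ (1 + m)⁻¹ 0
    have e1 := lyap_pos m⁻¹ (1 + m)⁻¹ 0
    have e2 := lyap_neg m⁻¹ (1 + m)⁻¹ 1
    norm_num at e0 e1 e2
    simp only [slowGen, xi]
    norm_num
    rw [e0, e1, e2]
    linarith
  · have e0 := lyap_neg m⁻¹ (1 + m)⁻¹ 0
    have e1 := lyap_pos m⁻¹ (1 + m)⁻¹ 0
    have e2 := lyap_pos m⁻¹ (1 + m)⁻¹ 1
    norm_num at e0 e1 e2
    simp only [slowGen, xi]
    norm_num
    rw [e0, e1, e2]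
    linarith
  · have e0 := lyap_neg m⁻¹ (1 + m)⁻¹ k
    have e1 := lyap_neg m⁻¹ (1 + m)⁻¹ (k + 1)
    have e2 := lyap_neg m⁻¹ (1 + m)⁻¹ (k + 2)
    push_cast at e0 e1 e2
    have h1 : ¬ (-((k : ℤ) + 1) = 0) := by omega
    have h2 : ¬ (-((k : ℤ) + 1) - 1 = 0) := by omega
    have h3 : ¬ (-((k : ℤ) + 1) = 1) := by omega
    have h4 : -((k : ℤ) + 1) + 1 = -(k : ℤ) := by ring
    have h5 : -((k : ℤ) + 1) - 1 = -((k : ℤ) + 2) := by ring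
    simp only [slowGen, xi, if_neg h2, h1, h3, or_self, if_false]
    rw [h4, h5, e0, e1, e2]
    linarith [key k]
  · have e0 := lyap_pos m⁻¹ (1 + m)⁻¹ k
    have e1 := lyap_pos m⁻¹ (1 + m)⁻¹ (k + 1)
    have e2 := lyap_pos m⁻¹ (1 + m)⁻¹ (k + 2)
    push_cast at e0 e1 e2
    have h1 : ¬ ((k : ℤ) + 2 = 0) := by omega
    have h2 : ¬ ((k : ℤ) + 2 - 1 = 0) := by omega
    have h3 : ¬ ((k : ℤ) + 2 = 1) := by omega
    have h4 : (k : ℤ) + 2 = (k : ℤ) + 1 + 1 := by ring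
    have h5 : (k : ℤ) + 2 - 1 = (k : ℤ) + 1 := by ring
    simp only [slowGen, xi, if_neg h2, h1, h3, or_self, if_false]
    rw [h5, e2, e0, h4, e1]
    linarith [key k]

/-- **One-dimensional local time estimate** (Lemma 4.3). The expected time spent in `{0,1}`
up to time `t` by the continuous-time random walk with generator `n²𝒜_n` is at most `C√t/n`. -/
theorem local_time_slow_walk_dim_one (α : ℝ) (hα : 0 < α) :
    ∃ C : ℝ, 0 < C ∧ ∀ n : ℕ, 1 ≤ n →
      ∀ A : (ℤ →ᵇ ℝ) →L[ℝ] (ℤ →ᵇ ℝ),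
        (∀ f : ℤ →ᵇ ℝ, ∀ x : ℤ,
          A f x = xi α n x * (f (x + 1) - f x) + xi α n (x - 1) * (f (x - 1) - f x)) →
      ∀ χ : ℤ →ᵇ ℝ, (∀ x : ℤ, χ x = if x = 0 ∨ x = 1 then 1 else 0) →
      ∀ x : ℤ, ∀ t : ℝ, 0 ≤ t →
        (∫ s in (0 : ℝ)..t, expApply A (s * (n : ℝ) ^ 2) χ x) ≤ C * Real.sqrt t / n := by
  refine ⟨2, by norm_num, ?_⟩
  intro n hn A hA χ hχ x t ht
  have hn0 : (0 : ℝ) < n := by exact_mod_cast hn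
  rcases ht.eq_or_lt with rfl | ht
  · simp
  have hst : 0 < Real.sqrt t := Real.sqrt_pos.2 ht
  have hsq : Real.sqrt t ^ 2 = t := Real.sq_sqrt ht.le
  set m : ℝ := ((n : ℝ) * Real.sqrt t)⁻¹ with hm
  have hm0 : 0 < m := by positivity
  have hr0 : 0 ≤ (1 + m)⁻¹ := by positivity
  have hr1 : (1 + m)⁻¹ ≤ 1 := inv_le_one_of_one_le₀ (by linarith)
  have hl0 : ∀ y, 0 ≤ lyap m⁻¹ (1 + m)⁻¹ y := fun y => by unfold lyap; positivity
  have hl1 : ∀ y, lyap m⁻¹ (1 + m)⁻¹ y ≤ m⁻¹ := fun y => by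
    unfold lyap
    exact mul_le_of_le_one_right (by positivity) (pow_le_one₀ hr0 hr1)
  let f : ℤ →ᵇ ℝ := BoundedContinuousFunction.ofNormedAddCommGroupDiscrete
    (lyap m⁻¹ (1 + m)⁻¹) m⁻¹ (fun y => by
      rw [Real.norm_of_nonneg (hl0 y)]; exact hl1 y)
  have hf : ∀ y, f y = lyap m⁻¹ (1 + m)⁻¹ y := fun y => rfl
  have hxi0 : ∀ y, 0 ≤ xi α n y := fun y => by
    unfold xi; split_ifs <;> positivity
  have hxi1 : ∀ y, xi α n y ≤ 1 + α / n := fun y => by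
    have : 0 ≤ α / n := by positivity
    unfold xi; split_ifs <;> linarith
  have hP : ∀ s : ℝ, 0 ≤ s → ∀ g : ℤ →ᵇ ℝ, (∀ y, 0 ≤ g y) → ∀ y,
      0 ≤ opExp A s g y := by
    intro s hs g hg y
    refine exp_pos_shift A (2 * (1 + α / n)) ?_ s hs g hg y
    intro g hg y
    rw [hA]
    have a1 := mul_nonneg (hxi0 y) (hg (y + 1))
    have a2 := mul_nonneg (hxi0 (y - 1)) (hg (y - 1))
    have a3 := mul_le_mul_of_nonneg_right (hxi1 y) (hg y)
    have a4 := mul_le_mul_of_nonneg_right (hxi1 (y - 1)) (hg y)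
    linarith
  let one : ℤ →ᵇ ℝ := BoundedContinuousFunction.const ℤ 1
  have hone : ∀ s : ℝ, opExp A s one = one := fun s =>
    exp_one_apply A s one (by ext y; rw [hA]; simp [one])
  have hχe : ∀ s : ℝ, expApply A s χ = opExp A s χ := fun s =>
    (expApply_eq A s χ).tsum_eq
  -- derivative
  have hder : ∀ g : ℤ →ᵇ ℝ, ∀ s : ℝ,
      HasDerivAt (fun s : ℝ => opExp A (s * (n : ℝ) ^ 2) g x)
        (opExp A (s * (n : ℝ) ^ 2) (A g) x * (n : ℝ) ^ 2) s := by
    intro g s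
    exact opExp_deriv A g (BoundedContinuousFunction.evalCLM ℝ x) ((n : ℝ) ^ 2) s
  have hcont : ∀ g : ℤ →ᵇ ℝ,
      Continuous (fun s : ℝ => opExp A (s * (n : ℝ) ^ 2) g x) := fun g =>
    continuous_iff_continuousAt.2 fun s => (hder g s).continuousAt
  have hFTC : ∫ s in (0 : ℝ)..t, opExp A (s * (n : ℝ) ^ 2) (A f) x * (n : ℝ) ^ 2
      = opExp A (t * (n : ℝ) ^ 2) f x - f x := by
    rw [intervalIntegral.integral_eq_sub_of_hasDerivAt (fun s _ => hder f s)
      (((hcont (A f)).mul continuous_const).intervalIntegrable _ _)]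
    rw [zero_mul, opExp_zero]
  have hpt : ∀ s : ℝ, 0 ≤ s → opExp A s χ x ≤
      m - opExp A s (A f) x := by
    intro s hs
    have := hP s hs (m • one - A f - χ) (by
      intro y
      have h1 := lyap_gen α n m hm0 y
      have h2 : A f y = slowGen α n (lyap m⁻¹ (1 + m)⁻¹) y := hA f y
      have h3 : m ^ 2 * lyap m⁻¹ (1 + m)⁻¹ y ≤ m ^ 2 * m⁻¹ :=
        mul_le_mul_of_nonneg_left (hl1 y) (by positivity)
      have h4 : m ^ 2 * m⁻¹ = m := by field_simp
      have h5 : (m • one - A f - χ) y = m - A f y - χ y := by simp [one]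
      rw [h5, hχ, h2]
      linarith) x
    rw [map_sub, map_sub, map_smul, hone] at this
    simp [one] at this
    linarith
  have hI : (∫ s in (0 : ℝ)..t, expApply A (s * (n : ℝ) ^ 2) χ x) ≤
      ∫ s in (0 : ℝ)..t, (m - opExp A (s * (n : ℝ) ^ 2) (A f) x) := by
    simp only [hχe]
    refine intervalIntegral.integral_mono_on ht.le ((hcont χ).intervalIntegrable _ _)
      ((continuous_const.sub (hcont (A f))).intervalIntegrable _ _) ?_
    intro s hs
    exact hpt _ (mul_nonneg hs.1 (by positivity))
  refine hI.trans ?_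
  rw [intervalIntegral.integral_sub (by simp) ((hcont (A f)).intervalIntegrable _ _)]
  rw [intervalIntegral.integral_mul_const] at hFTC
  set J := ∫ s in (0 : ℝ)..t, opExp A (s * (n : ℝ) ^ 2) (A f) x
  have hfin : -J ≤ Real.sqrt t / n := by
    have h1 := hP (t * (n : ℝ) ^ 2) (by positivity) f hl0 x
    have h2 : f x ≤ n * Real.sqrt t := by
      have h3 : m⁻¹ = n * Real.sqrt t := by rw [hm, inv_inv]
      exact h3 ▸ (hf x).le.trans (hl1 x)
    rw [le_div_iff₀ hn0]
    have h3 : (-J * n) * n ≤ Real.sqrt t * n := by nlinarith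
    exact le_of_mul_le_mul_right h3 hn0
  have hfin2 : t * m = Real.sqrt t / n := by
    rw [hm]
    nth_rewrite 1 [← hsq]
    field_simp
  simp only [intervalIntegral.integral_const, sub_zero, smul_eq_mul]
  rw [hfin2]
  have : 2 * Real.sqrt t / n = Real.sqrt t / n + Real.sqrt t / n := by ring
  linarith
end

section
/- Fix α > 0. There exists a constant c > 0 such that for all n ∈ ℕ (n ≥ 1), all (x,y) ∈ V and all t > 0 with tn² ≥ 2: ∫₀^{tn²} (e^{s𝐁_n} 𝟙_{{(0,1)}})((x,y)) ds ≤ c log(tn²); that is, the expected local time at the vertex (0,1) up to time tn² of the continuous-time random walk generated by 𝐁_n started at (x,y) is at most c log(tn²). -/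
open MeasureTheory Filter
open scoped BoundedContinuousFunction NNReal

/-- `p` lies in `V = {(x,y) : y ≥ x+1}`. -/
def inV (p : ℤ × ℤ) : Prop := p.1 + 1 ≤ p.2

/-- `p` lies in the set `U` of vertices attached to the slow edges. -/
def inU (p : ℤ × ℤ) : Prop :=
  inV p ∧ (((p.1 = 0 ∨ p.1 = 1) ∧ 2 ≤ p.2) ∨ (p.1 ≤ -1 ∧ (p.2 = 0 ∨ p.2 = 1)))

/-- The `L¹` distance on `ℤ²`. -/
def dist1 (u v : ℤ × ℤ) : ℤ := |u.1 - v.1| + |u.2 - v.2|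

/-- The pair `(u,v)` is a slow edge, i.e. belongs to `𝒰`. -/
def slowPair (u v : ℤ × ℤ) : Prop :=
  inU u ∧ inU v ∧ dist1 u v = 1 ∧
    ((|u.1 - v.1| = 1 ∧ 2 ≤ u.2 ∧ 2 ≤ v.2) ∨ (|u.2 - v.2| = 1 ∧ u.1 ≤ -1 ∧ v.1 ≤ -1))

open Classical in
/-- The jump rates `c_n(u,v)` of the two-dimensional random walk on `V`:
`α/n` along slow edges, `1` along other nearest-neighbour edges, `0` otherwise. -/
noncomputable def cRate (α : ℝ) (n : ℕ) (u v : ℤ × ℤ) : ℝ :=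
  if slowPair u v then α / n else if dist1 u v = 1 then 1 else 0

/-- The set `V = {(x,y) ∈ ℤ² : y ≥ x+1}` as a type. -/
abbrev Vslice : Type := {p : ℤ × ℤ // p.1 + 1 ≤ p.2}

/-- Logarithmic test function. -/
noncomputable def fT (T N : ℝ) : ℝ := Real.log (N + 2 + T) - Real.log (N + 2)

/-- Squared doubled distance to `(1/2,1/2)`. -/
noncomputable def NN (p : ℤ × ℤ) : ℝ := (2 * (p.1 : ℝ) - 1) ^ 2 + (2 * (p.2 : ℝ) - 1) ^ 2

lemma NN_nonneg (p : ℤ × ℤ) : 0 ≤ NN p := by unfold NN; positivity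

lemma odd_sq_ge (x : ℤ) : (1 : ℝ) ≤ (2 * (x : ℝ) - 1) ^ 2 := by
  have : (1 : ℤ) ≤ (2 * x - 1) ^ 2 := by
    rcases le_or_gt x 0 with h | h <;> nlinarith
  exact_mod_cast this

lemma NN_ge (p : ℤ × ℤ) : 2 ≤ NN p := by
  unfold NN; linarith [odd_sq_ge p.1, odd_sq_ge p.2]

lemma fT_nonneg {T N : ℝ} (hT : 0 ≤ T) (hN : 0 ≤ N) : 0 ≤ fT T N := by
  unfold fT
  have := Real.log_le_log (by linarith : 0 < N + 2) (by linarith : N + 2 ≤ N + 2 + T)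
  linarith

lemma fT_le {T N : ℝ} (hT : 2 ≤ T) (hN : 2 ≤ N) : fT T N ≤ Real.log T := by
  unfold fT
  have h : Real.log (N + 2 + T) ≤ Real.log (T * (N + 2)) :=
    Real.log_le_log (by linarith) (by nlinarith)
  rw [Real.log_mul (by linarith) (by linarith)] at h
  linarith

lemma log_diff_le {a b : ℝ} (ha : 0 < a) (hb : 0 < b) :
    Real.log b - Real.log a ≤ (b - a) / a := by
  rw [← Real.log_div hb.ne' ha.ne']
  have := Real.log_le_sub_one_of_pos (div_pos hb ha)
  have e : (b - a) / a = b / a - 1 := by field_simp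
  linarith

/-- Full lattice Laplacian is nonpositive up to `16/T`. -/
lemma full_lap {T : ℝ} (hT : 0 < T) (p q : ℝ) :
    fT T ((p + 2) ^ 2 + q ^ 2) + fT T ((p - 2) ^ 2 + q ^ 2) + fT T (p ^ 2 + (q + 2) ^ 2)
      + fT T (p ^ 2 + (q - 2) ^ 2) - 4 * fT T (p ^ 2 + q ^ 2) ≤ 16 / T := by
  unfold fT
  set a := (p + 2) ^ 2 + q ^ 2 + 2 with ha
  set b := (p - 2) ^ 2 + q ^ 2 + 2 with hb
  set c := p ^ 2 + (q + 2) ^ 2 + 2 with hc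
  set d := p ^ 2 + (q - 2) ^ 2 + 2 with hd
  set S := p ^ 2 + q ^ 2 + 2 with hS
  have a0 : 0 < a := by positivity
  have b0 : 0 < b := by positivity
  have c0 : 0 < c := by positivity
  have d0 : 0 < d := by positivity
  have S0 : 0 < S := by positivity
  have h1 : 4 * Real.log S ≤ Real.log a + Real.log b + Real.log c + Real.log d := by
    rw [← Real.log_mul a0.ne' b0.ne', ← Real.log_mul (by positivity) c0.ne',
      ← Real.log_mul (by positivity) d0.ne']
    have : 4 * Real.log S = Real.log (S ^ 4) := by rw [Real.log_pow]; norm_num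
    rw [this]
    apply Real.log_le_log (by positivity)
    have : a * b * c * d = S ^ 4 + (256 * S + 768 + 256 * (p * q) ^ 2) := by
      rw [ha, hb, hc, hd, hS]; ring
    rw [this]
    have : 0 ≤ 256 * S + 768 + 256 * (p * q) ^ 2 := by positivity
    linarith
  have ST : 0 < S + T := by positivity
  have e1 := log_diff_le ST (by positivity : 0 < a + T)
  have e2 := log_diff_le ST (by positivity : 0 < b + T)
  have e3 := log_diff_le ST (by positivity : 0 < c + T)
  have e4 := log_diff_le ST (by positivity : 0 < d + T)
  have e5 : (a + T - (S + T)) / (S + T) + (b + T - (S + T)) / (S + T)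
      + (c + T - (S + T)) / (S + T) + (d + T - (S + T)) / (S + T) = 16 / (S + T) := by
    rw [← add_div, ← add_div, ← add_div]
    congr 1
    rw [ha, hb, hc, hd, hS]; ring
  have e6 : 16 / (S + T) ≤ 16 / T := by
    apply div_le_div_of_nonneg_left <;> linarith
  linarith

lemma diag_convex {T : ℝ} (hT : 0 < T) (p q : ℝ) :
    2 * fT T (p ^ 2 + q ^ 2) ≤ fT T (p ^ 2 + p ^ 2) + fT T (q ^ 2 + q ^ 2) := by
  unfold fT
  set X := p ^ 2 + p ^ 2 + 2 with hX
  set Y := q ^ 2 + q ^ 2 + 2 with hY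
  set m := p ^ 2 + q ^ 2 + 2 with hm
  have X0 : 0 < X := by positivity
  have Y0 : 0 < Y := by positivity
  have m0 : 0 < m := by positivity
  have key : Real.log ((X * Y) * (m + T) ^ 2) ≤ Real.log (((X + T) * (Y + T)) * m ^ 2) := by
    apply Real.log_le_log (by positivity)
    have hd : 0 ≤ m ^ 2 - X * Y := by
      have : m ^ 2 - X * Y = (p ^ 2 - q ^ 2) ^ 2 := by rw [hm, hX, hY]; ring
      rw [this]; positivity
    have h2 : X + Y = 2 * m := by rw [hm, hX, hY]; ring
    have : ((X + T) * (Y + T)) * m ^ 2 - (X * Y) * (m + T) ^ 2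
        = (m ^ 2 - X * Y) * (2 * m * T + T ^ 2) := by
      have hY' : Y = 2 * m - X := by linarith
      rw [hY']; ring
    have h3 : 0 ≤ (m ^ 2 - X * Y) * (2 * m * T + T ^ 2) := mul_nonneg hd (by positivity)
    linarith
  rw [Real.log_mul (by positivity) (by positivity), Real.log_mul (by positivity) (by positivity),
    Real.log_mul (by positivity) (by positivity), Real.log_mul (by positivity) (by positivity),
    Real.log_pow, Real.log_pow] at key
  push_cast at key
  linarith

lemma corner_lap {T : ℝ} (hT : 0 < T) :
    2 * (fT T 10 - fT T 2) ≤ -1 + 16 / T := by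
  unfold fT
  have e1 := log_diff_le (by positivity : 0 < 2 + 2 + T) (by positivity : 0 < 10 + 2 + T)
  have e6 : (10 + 2 + T - (2 + 2 + T)) / (2 + 2 + T) ≤ 8 / T := by
    have : 10 + 2 + T - (2 + 2 + T) = 8 := by ring
    rw [this]
    apply div_le_div_of_nonneg_left <;> linarith
  have e7 : (16 : ℝ) / T = 2 * (8 / T) := by ring
  have e8 : Real.log (10 + 2) = Real.log 3 + Real.log (2 + 2) := by
    rw [← Real.log_mul (by norm_num) (by norm_num)]; norm_num
  have e9 : Real.log 2 ≤ Real.log 3 := Real.log_le_log (by norm_num) (by norm_num)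
  have hl := Real.log_two_gt_d9
  rw [e8, e7]
  have e10 := e1.trans e6
  generalize Real.log (10 + 2 + T) = P at *
  generalize Real.log (2 + 2 + T) = Q at *
  generalize Real.log (2 + 2) = R at *
  norm_num at hl
  linarith

lemma dist1_iff (x y : ℤ) (v : ℤ × ℤ) : dist1 (x, y) v = 1 ↔
    v = (x + 1, y) ∨ v = (x - 1, y) ∨ v = (x, y + 1) ∨ v = (x, y - 1) := by
  obtain ⟨a, b⟩ := v
  simp only [dist1, Prod.mk.injEq]
  constructor
  · intro h
    rcases abs_cases (x - a) with h1 | h1 <;> rcases abs_cases (y - b) with h2 | h2 <;> omega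
  · rintro (⟨rfl, rfl⟩ | ⟨rfl, rfl⟩ | ⟨rfl, rfl⟩ | ⟨rfl, rfl⟩) <;> simp

lemma cRate_zero {α : ℝ} {n : ℕ} {u v : ℤ × ℤ} (h : dist1 u v ≠ 1) : cRate α n u v = 0 := by
  unfold cRate
  rw [if_neg (fun hs => h hs.2.2.1), if_neg h]

lemma cRate_nonneg {α : ℝ} (hα : 0 < α) (n : ℕ) (u v : ℤ × ℤ) : 0 ≤ cRate α n u v := by
  unfold cRate
  split_ifs <;> positivity

lemma cRate_le {α : ℝ} (hα : 0 < α) {n : ℕ} (hn : 1 ≤ n) (u v : ℤ × ℤ) :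
    cRate α n u v ≤ 1 + α := by
  unfold cRate
  have : α / n ≤ α := div_le_self hα.le (by exact_mod_cast hn)
  split_ifs <;> linarith

open Classical in
lemma tsum_nbr (α : ℝ) (n : ℕ) (x y : ℤ) (G : ℤ × ℤ → ℝ) :
    ∑' v : Vslice, cRate α n (x, y) v.1 * G v.1 =
      (if inV (x + 1, y) then cRate α n (x, y) (x + 1, y) * G (x + 1, y) else 0)
      + (if inV (x - 1, y) then cRate α n (x, y) (x - 1, y) * G (x - 1, y) else 0)
      + (if inV (x, y + 1) then cRate α n (x, y) (x, y + 1) * G (x, y + 1) else 0)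
      + (if inV (x, y - 1) then cRate α n (x, y) (x, y - 1) * G (x, y - 1) else 0) := by
  have h0 := tsum_subtype {p : ℤ × ℤ | p.1 + 1 ≤ p.2} (fun p => cRate α n (x, y) p * G p)
  have h1 : ∑' v : Vslice, cRate α n (x, y) v.1 * G v.1 =
      ∑' p : ℤ × ℤ, ({p : ℤ × ℤ | p.1 + 1 ≤ p.2}).indicator
        (fun p => cRate α n (x, y) p * G p) p := h0
  rw [h1, tsum_eq_sum (s := {(x + 1, y), (x - 1, y), (x, y + 1), (x, y - 1)})]
  · rw [Finset.sum_insert, Finset.sum_insert, Finset.sum_insert, Finset.sum_singleton]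
    · simp only [Set.indicator_apply, Set.mem_ofPred_eq, inV]
      ring_nf
    all_goals simp only [Finset.mem_insert, Finset.mem_singleton, Prod.mk.injEq]; omega
  · intro p hp
    simp only [Finset.mem_insert, Finset.mem_singleton] at hp
    rw [Set.indicator_apply]
    have : dist1 (x, y) p ≠ 1 := fun h => hp ((dist1_iff x y p).1 h)
    rw [cRate_zero this]; simp

lemma slow_NN {u v : ℤ × ℤ} (h : slowPair u v) : NN v = NN u := by
  obtain ⟨a, b⟩ := u
  obtain ⟨c, d⟩ := v
  have hh : (c = a ∨ c = 1 - a) ∧ (d = b ∨ d = 1 - b) := by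
    unfold slowPair inU inV dist1 at h
    simp only at h
    rcases abs_cases (a - c) with h1 | h1 <;> rcases abs_cases (b - d) with h2 | h2 <;> omega
  unfold NN
  obtain ⟨rfl | rfl, rfl | rfl⟩ := hh <;> push_cast <;> ring

lemma cRate_mul {α : ℝ} {n : ℕ} (T : ℝ) {u v : ℤ × ℤ} (h : dist1 u v = 1) :
    cRate α n u v * (fT T (NN v) - fT T (NN u)) = fT T (NN v) - fT T (NN u) := by
  by_cases hs : slowPair u v
  · rw [slow_NN hs]; simp
  · unfold cRate; rw [if_neg hs, if_pos h, one_mul]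

lemma lyapunov (α : ℝ) (n : ℕ) {T : ℝ} (hT : 0 < T) (u : Vslice) :
    ∑' v : Vslice, cRate α n u.1 v.1 * (fT T (NN v.1) - fT T (NN u.1))
      ≤ -(if u.1 = ((0 : ℤ), (1 : ℤ)) then 1 else 0) + 16 / T := by
  obtain ⟨⟨x, y⟩, hu⟩ := u
  simp only at hu ⊢
  rw [tsum_nbr α n x y (fun p => fT T (NN p) - fT T (NN (x, y)))]
  rw [cRate_mul T ((dist1_iff x y _).2 (by simp)), cRate_mul T ((dist1_iff x y _).2 (by simp)),
    cRate_mul T ((dist1_iff x y _).2 (by simp)), cRate_mul T ((dist1_iff x y _).2 (by simp))]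
  have i2 : inV (x - 1, y) := by simp only [inV]; omega
  have i3 : inV (x, y + 1) := by simp only [inV]; omega
  rw [if_pos i2, if_pos i3]
  have L := full_lap hT (2 * (x : ℝ) - 1) (2 * (y : ℝ) - 1)
  have n0 : NN (x, y) = (2 * (x : ℝ) - 1) ^ 2 + (2 * (y : ℝ) - 1) ^ 2 := rfl
  have n1 : NN (x + 1, y) = (2 * (x : ℝ) - 1 + 2) ^ 2 + (2 * (y : ℝ) - 1) ^ 2 := by
    simp only [NN]; push_cast; ring
  have n2 : NN (x - 1, y) = (2 * (x : ℝ) - 1 - 2) ^ 2 + (2 * (y : ℝ) - 1) ^ 2 := by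
    simp only [NN]; push_cast; ring
  have n3 : NN (x, y + 1) = (2 * (x : ℝ) - 1) ^ 2 + (2 * (y : ℝ) - 1 + 2) ^ 2 := by
    simp only [NN]; push_cast; ring
  have n4 : NN (x, y - 1) = (2 * (x : ℝ) - 1) ^ 2 + (2 * (y : ℝ) - 1 - 2) ^ 2 := by
    simp only [NN]; push_cast; ring
  rw [← n0, ← n1, ← n2, ← n3, ← n4] at L
  by_cases hd : x + 2 ≤ y
  · have i1 : inV (x + 1, y) := by simp only [inV]; omega
    have i4 : inV (x, y - 1) := by simp only [inV]; omega
    have ne : ¬ ((x, y) = ((0 : ℤ), (1 : ℤ))) := by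
      simp only [Prod.mk.injEq]; omega
    rw [if_pos i1, if_pos i4, if_neg ne]
    linarith
  · have hy : y = x + 1 := by omega
    have i1 : ¬ inV (x + 1, y) := by simp only [inV]; omega
    have i4 : ¬ inV (x, y - 1) := by simp only [inV]; omega
    rw [if_neg i1, if_neg i4]
    by_cases hx : x = 0
    · subst hx
      have hy1 : y = 1 := by omega
      subst hy1
      rw [if_pos rfl, n2, n3, n0]
      have := corner_lap hT
      norm_num at this ⊢
      linarith
    · have ne : ¬ ((x, y) = ((0 : ℤ), (1 : ℤ))) := by
        simp only [Prod.mk.injEq]; omega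
      rw [if_neg ne]
      have D := diag_convex hT (2 * (x : ℝ) - 1) (2 * (y : ℝ) - 1)
      have m1 : NN (x + 1, y) = (2 * (y : ℝ) - 1) ^ 2 + (2 * (y : ℝ) - 1) ^ 2 := by
        rw [n1, hy]; push_cast; ring
      have m4 : NN (x, y - 1) = (2 * (x : ℝ) - 1) ^ 2 + (2 * (x : ℝ) - 1) ^ 2 := by
        rw [n4, hy]; push_cast; ring
      rw [← n0, ← m1, ← m4] at D
      linarith

abbrev EV := Vslice →ᵇ ℝ

open Classical in
lemma gen_lower {α : ℝ} (hα : 0 < α) {n : ℕ} (hn : 1 ≤ n) (f : EV) (hf : ∀ v, 0 ≤ f v)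
    (u : Vslice) :
    0 ≤ ∑' v : Vslice, cRate α n u.1 v.1 * (f v - f u) + (4 * (1 + α)) * f u := by
  obtain ⟨⟨x, y⟩, hu⟩ := u
  set w : Vslice := ⟨(x, y), hu⟩ with hw
  let F : ℤ × ℤ → ℝ := fun p => if h : p.1 + 1 ≤ p.2 then f ⟨p, h⟩ else 0
  have hF : ∀ p, 0 ≤ F p := by
    intro p; simp only [F]; split_ifs
    · exact hf _
    · exact le_rfl
  have hFv : ∀ v : Vslice, f v = F v.1 := by
    intro v; simp only [F]; rw [dif_pos v.2]
  have h1 : ∑' v : Vslice, cRate α n w.1 v.1 * (f v - f w)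
      = ∑' v : Vslice, cRate α n (x, y) v.1 * ((fun p => F p - f w) v.1) := by
    apply tsum_congr; intro v; simp only [hFv v]; rfl
  rw [h1, tsum_nbr α n x y (fun p => F p - f w)]
  have key : ∀ p : ℤ × ℤ, -((1 + α) * f w) ≤
      (if inV p then cRate α n (x, y) p * (F p - f w) else 0) := by
    intro p
    have := hf w
    have c1 := cRate_nonneg hα n (x, y) p
    have c2 := cRate_le hα hn (x, y) p
    have := hF p
    split_ifs
    · nlinarith [mul_nonneg c1 this, mul_le_mul_of_nonneg_right c2 (hf w)]
    · nlinarith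
  have k1 := key (x + 1, y)
  have k2 := key (x - 1, y)
  have k3 := key (x, y + 1)
  have k4 := key (x, y - 1)
  linarith

section generic
variable {E : Type*} [NormedAddCommGroup E] [NormedSpace ℝ E] [CompleteSpace E]

lemma expApply_hasSum (A : E →L[ℝ] E) (t : ℝ) (f : E) :
    HasSum (fun k : ℕ => (t ^ k / (k.factorial : ℝ)) • ((A ^ k) f))
      (NormedSpace.exp (t • A) f) := by
  have h := NormedSpace.exp_series_hasSum_exp' (𝕂 := ℝ) (t • A)
  have h2 := h.mapL (ContinuousLinearMap.apply ℝ E f)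
  convert h2 using 1
  swap
  · rfl
  funext k
  simp only [ContinuousLinearMap.apply_apply, smul_apply, smul_pow, smul_smul]
  congr 1
  rw [div_eq_inv_mul]

lemma expApply_eq_s5 (A : E →L[ℝ] E) (t : ℝ) (f : E) :
    expApply A t f = NormedSpace.exp (t • A) f := (expApply_hasSum A t f).tsum_eq

lemma exp_pos_of_pos_s5 {ι : Type*} (ev : ι → E →L[ℝ] ℝ) (A : E →L[ℝ] E)
    (hA : ∀ f : E, (∀ v, 0 ≤ ev v f) → ∀ v, 0 ≤ ev v (A f))
    {t : ℝ} (ht : 0 ≤ t) (f : E) (hf : ∀ v, 0 ≤ ev v f) (u : ι) :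
    0 ≤ ev u (NormedSpace.exp (t • A) f) := by
  have hk : ∀ k : ℕ, ∀ v, 0 ≤ ev v ((A ^ k) f) := by
    intro k
    induction k with
    | zero => simpa using hf
    | succ k ih =>
      rw [pow_succ']
      exact hA _ ih
  have h := (expApply_hasSum A t f).mapL (ev u)
  refine h.nonneg ?_
  intro k
  rw [map_smul, smul_eq_mul]
  exact mul_nonneg (by positivity) (hk k u)

lemma exp_pos_gen {ι : Type*} (ev : ι → E →L[ℝ] ℝ) (B : E →L[ℝ] E) (l : ℝ)
    (hB : ∀ f : E, (∀ v, 0 ≤ ev v f) → ∀ v, 0 ≤ ev v (B f) + l * ev v f)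
    {t : ℝ} (ht : 0 ≤ t) (f : E) (hf : ∀ v, 0 ≤ ev v f) (u : ι) :
    0 ≤ ev u (NormedSpace.exp (t • B) f) := by
  have h1 : t • B = t • (B + l • (1 : E →L[ℝ] E)) + (-(t * l)) • (1 : E →L[ℝ] E) := by
    rw [smul_add, smul_smul, add_assoc, ← add_smul]; simp
  have hc : Commute (t • (B + l • (1 : E →L[ℝ] E))) ((-(t * l)) • (1 : E →L[ℝ] E)) :=
    (Commute.one_right _).smul_right _
  have h3 : NormedSpace.exp ((-(t * l)) • (1 : E →L[ℝ] E))
      = Real.exp (-(t * l)) • (1 : E →L[ℝ] E) := by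
    have := NormedSpace.algebraMap_exp_comm (𝕂 := ℝ) (𝔸 := E →L[ℝ] E) (-(t * l))
    rw [Algebra.algebraMap_eq_smul_one, Algebra.algebraMap_eq_smul_one] at this
    rw [← this, Real.exp_eq_exp_ℝ]
  let _ : NormedAlgebra ℚ (E →L[ℝ] E) := NormedAlgebra.restrictScalars ℚ ℝ _
  rw [h1, NormedSpace.exp_add_of_commute hc, h3]
  have := exp_pos_of_pos_s5 ev (B + l • (1 : E →L[ℝ] E)) (by
    intro g hg v
    simpa using hB g hg v) ht f hf u
  simp only [mul_smul_comm, mul_one, smul_apply, map_smul, smul_eq_mul]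
  exact mul_nonneg (Real.exp_pos _).le this

lemma exp_fix (B : E →L[ℝ] E) (f : E) (hf : B f = 0) (t : ℝ) :
    NormedSpace.exp (t • B) f = f := by
  rw [← expApply_eq_s5, expApply, tsum_eq_single 0]
  · simp
  · intro k hk
    obtain ⟨m, rfl⟩ := Nat.exists_eq_succ_of_ne_zero hk
    have : (B ^ m.succ) f = (B ^ m) (B f) := by rw [pow_succ]; rfl
    rw [this, hf]; simp

lemma exp_deriv (B : E →L[ℝ] E) (f : E) (ℓ : E →L[ℝ] ℝ) (t : ℝ) :
    HasDerivAt (fun s : ℝ => ℓ (NormedSpace.exp (s • B) f))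
      (ℓ (NormedSpace.exp (t • B) (B f))) t := by
  have h := hasDerivAt_exp_smul_const (𝕂 := ℝ) B t
  exact ((ℓ.comp (ContinuousLinearMap.apply ℝ E f)).hasFDerivAt).comp_hasDerivAt t h

lemma exp_cont (B : E →L[ℝ] E) (f : E) (ℓ : E →L[ℝ] ℝ) :
    Continuous (fun s : ℝ => ℓ (NormedSpace.exp (s • B) f)) :=
  continuous_iff_continuousAt.2 fun t => (exp_deriv B f ℓ t).continuousAt

/-- Lyapunov criterion for a bound on the integrated semigroup. -/
lemma integrated_bound {ι : Type*} (ev : ι → E →L[ℝ] ℝ) (B : E →L[ℝ] E) (l : ℝ)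
    (hB : ∀ f : E, (∀ v, 0 ≤ ev v f) → ∀ v, 0 ≤ ev v (B f) + l * ev v f)
    (φ one χ : E) (hone : ∀ v, ev v one = 1) (hB1 : B one = 0) (hφ : ∀ v, 0 ≤ ev v φ)
    {T : ℝ} (T0 : 0 < T) (hlyap : ∀ v, ev v (B φ) ≤ - ev v χ + 16 / T) (u : ι) :
    ∫ s in (0 : ℝ)..T, ev u (expApply B s χ) ≤ ev u φ + 16 := by
  have hpt : ∀ s ∈ Set.Icc (0 : ℝ) T, ev u (expApply B s χ) ≤
      -(ev u (NormedSpace.exp (s • B) (B φ))) + 16 / T := by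
    intro s hs
    have h := exp_pos_gen ev B l hB hs.1 (-(B φ) + (16 / T) • one - χ) (by
      intro v
      have := hlyap v
      simp only [map_sub, map_add, map_neg, map_smul, smul_eq_mul, hone]
      linarith) u
    rw [map_sub, map_add, map_neg, map_smul, exp_fix B one hB1] at h
    simp only [map_sub, map_add, map_neg, map_smul, smul_eq_mul, hone] at h
    rw [expApply_eq_s5]
    linarith
  have hint : ∫ s in (0 : ℝ)..T, ev u (NormedSpace.exp (s • B) (B φ))
      = ev u (NormedSpace.exp (T • B) φ) - ev u (NormedSpace.exp ((0 : ℝ) • B) φ) :=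
    intervalIntegral.integral_eq_sub_of_hasDerivAt (fun s _ => exp_deriv B φ (ev u) s)
      ((exp_cont B (B φ) (ev u)).intervalIntegrable _ _)
  have hc1 : Continuous (fun s : ℝ => ev u (expApply B s χ)) := by
    simp only [expApply_eq_s5]; exact exp_cont B χ (ev u)
  have hc2 := exp_cont B (B φ) (ev u)
  have hle := intervalIntegral.integral_mono_on (μ := volume) T0.le (hc1.intervalIntegrable 0 T)
    (((hc2.neg.add (continuous_const (y := 16 / T)))).intervalIntegrable 0 T) hpt
  have hI : ∫ s in (0 : ℝ)..T, (-(ev u (NormedSpace.exp (s • B) (B φ))) + 16 / T)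
      = -(ev u (NormedSpace.exp (T • B) φ) - ev u φ) + 16 := by
    have hn : Continuous (fun s : ℝ => -(ev u (NormedSpace.exp (s • B) (B φ)))) := hc2.neg
    rw [intervalIntegral.integral_add (hn.intervalIntegrable 0 T)
      (continuous_const.intervalIntegrable 0 T), intervalIntegral.integral_neg, hint,
      intervalIntegral.integral_const, zero_smul, NormedSpace.exp_zero, sub_zero, smul_eq_mul,
      mul_div_cancel₀ _ T0.ne']
    simp
  have hp := exp_pos_gen ev B l hB T0.le φ hφ u
  refine hle.trans (hI.le.trans ?_)
  linarith

end generic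

/-- **Two-dimensional local time estimate at the slow vertex** (Proposition 3.1, second
part). The expected local time at `(0,1)` up to time `tn²` of the random walk generated by
`𝐁_n`, started anywhere in `V`, is at most `c log(tn²)`. -/
theorem local_time_slow_vertex_dim_two (α : ℝ) (hα : 0 < α) :
    ∃ c : ℝ, 0 < c ∧ ∀ n : ℕ, 1 ≤ n →
      ∀ B : (Vslice →ᵇ ℝ) →L[ℝ] (Vslice →ᵇ ℝ),
        (∀ f : Vslice →ᵇ ℝ, ∀ u : Vslice,
          B f u = ∑' v : Vslice, cRate α n u.1 v.1 * (f v - f u)) →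
      ∀ χpt : Vslice →ᵇ ℝ,
        (∀ u : Vslice, χpt u = if u.1 = ((0 : ℤ), (1 : ℤ)) then 1 else 0) →
      ∀ u : Vslice, ∀ t : ℝ, 0 < t → 2 ≤ t * (n : ℝ) ^ 2 →
        (∫ s in (0 : ℝ)..(t * (n : ℝ) ^ 2), expApply B s χpt u)
          ≤ c * Real.log (t * (n : ℝ) ^ 2) := by
  refine ⟨33, by norm_num, ?_⟩
  intro n hn B hB χ hχ u t ht hT
  set T := t * (n : ℝ) ^ 2 with hTdef
  have T0 : 0 < T := by linarith
  let φ : EV := BoundedContinuousFunction.ofNormedAddCommGroup (fun v : Vslice => fT T (NN v.1))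
    continuous_of_discreteTopology (Real.log T) (by
      intro v
      rw [Real.norm_eq_abs, abs_of_nonneg (fT_nonneg T0.le (NN_nonneg _))]
      exact fT_le hT (NN_ge _))
  let one : EV := BoundedContinuousFunction.const Vslice 1
  have hone : ∀ v, one v = 1 := fun v => rfl
  have hB1 : B one = 0 := by
    ext v; rw [hB]; simp [hone]
  have hle := integrated_bound (E := Vslice →ᵇ ℝ)
    (fun v : Vslice => BoundedContinuousFunction.evalCLM ℝ v) B
    (4 * (1 + α)) (by
      intro g hg w
      have h := gen_lower hα hn g hg w
      rw [← hB g w] at h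
      exact h) φ one χ hone hB1 (fun v => fT_nonneg T0.le (NN_nonneg _)) T0 (by
      intro v
      have h := lyapunov α n T0 v
      rw [← hχ v] at h
      refine le_trans (le_of_eq ?_) h
      exact hB φ v) u
  have hφu : φ u ≤ Real.log T := fT_le hT (NN_ge _)
  have hl : Real.log 2 ≤ Real.log T := Real.log_le_log (by norm_num) hT
  have := Real.log_two_gt_d9
  refine hle.trans ?_
  change φ u + 16 ≤ _
  linarith
end

section
/- Fix α > 0 and let f belong to the class S_α(ℝ). For each n ∈ ℕ (n ≥ 1) define f_n : ℤ → ℝ by f_n(x) = f(x/n), where f(0) is understood as the left limit f(0⁻) (f is continuous from the left at 0), and define Δ_α f : ℝ → ℝ by Δ_α f(u) = f''(u) for u ≠ 0 and Δ_α f(0) = f''(0⁺). Then there exists a constant C > 0 (depending on f and α) such that for all n ≥ 1: Σ_{x∈ℤ} | n² (𝒜_n f_n)(x) − (Δ_α f)(x/n) | ≤ C. In particular, for any function η̄ : ℤ → [−2,2], | n^{−1/2} Σ_{x∈ℤ} ( n² (𝒜_n f_n)(x) − (Δ_α f)(x/n) ) η̄(x) | ≤ C n^{−1/2}. -/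
open MeasureTheory Filter
open scoped BoundedContinuousFunction NNReal

/-- `f` belongs to the class `S_α(ℝ)` of test functions: smooth away from the origin,
continuous from the left at `0`, with fast decay of all derivatives, one-sided limits
of all derivatives at `0`, and satisfying the Robin-type boundary conditions
`f^{(2k+1)}(0⁺) = f^{(2k+1)}(0⁻) = α (f^{(2k)}(0⁺) − f^{(2k)}(0⁻))`. -/
structure IsSAlpha (α : ℝ) (f : ℝ → ℝ) : Prop where
  smooth : ContDiffOn ℝ (⊤ : ℕ∞) f {(0 : ℝ)}ᶜ
  left_cont : Filter.Tendsto f (nhdsWithin 0 (Set.Iio 0)) (nhds (f 0))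
  decay : ∀ k ℓ : ℕ, ∃ M : ℝ, ∀ u : ℝ, u ≠ 0 → (1 + |u| ^ ℓ) * |iteratedDeriv k f u| ≤ M
  robin : ∀ k : ℕ, ∃ Lp Lm Dp Dm : ℝ,
    Filter.Tendsto (iteratedDeriv (2 * k) f) (nhdsWithin 0 (Set.Ioi 0)) (nhds Lp) ∧
    Filter.Tendsto (iteratedDeriv (2 * k) f) (nhdsWithin 0 (Set.Iio 0)) (nhds Lm) ∧
    Filter.Tendsto (iteratedDeriv (2 * k + 1) f) (nhdsWithin 0 (Set.Ioi 0)) (nhds Dp) ∧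
    Filter.Tendsto (iteratedDeriv (2 * k + 1) f) (nhdsWithin 0 (Set.Iio 0)) (nhds Dm) ∧
    Dp = α * (Lp - Lm) ∧ Dm = α * (Lp - Lm)

/-- The discrepancy between the rescaled discrete slow-bond generator applied to
`x ↦ f(x/n)` and the operator `Δ_α f` evaluated at `x/n` (with `Δ_α f(0) = f''(0⁺)`). -/
noncomputable def discrepancy (α : ℝ) (f : ℝ → ℝ) (L2 : ℝ) (n : ℕ) (x : ℤ) : ℝ :=
  (n : ℝ) ^ 2 * slowGen α n (fun z : ℤ => f ((z : ℝ) / n)) x -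
    (if x = 0 then L2 else iteratedDeriv 2 f ((x : ℝ) / n))

lemma hasDerivAt_iter {α : ℝ} {f : ℝ → ℝ} (hf : IsSAlpha α f) (k : ℕ) {u : ℝ} (hu : u ≠ 0) :
    HasDerivAt (iteratedDeriv k f) (iteratedDeriv (k + 1) f u) u := by
  have ho : IsOpen ({(0 : ℝ)}ᶜ : Set ℝ) := isOpen_compl_singleton
  have h1 := hf.smooth.differentiableOn_iteratedDerivWithin (m := k)
    (by exact_mod_cast WithTop.coe_lt_top k) ho.uniqueDiffOn
  have h2 : DifferentiableAt ℝ (iteratedDeriv k f) u :=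
    (h1.congr (fun x hx => (iteratedDerivWithin_of_isOpen ho hx).symm)).differentiableAt
      (ho.mem_nhds hu)
  rw [iteratedDeriv_succ]
  exact h2.hasDerivAt

lemma taylor0 {g g' : ℝ → ℝ} {s : Set ℝ} (hs : Convex ℝ s) (hg : ∀ x ∈ s, HasDerivAt g (g' x) x)
    {K : ℝ} (hK : ∀ x ∈ s, |g' x| ≤ K) {a b : ℝ} (ha : a ∈ s) (hb : b ∈ s) :
    |g b - g a| ≤ K * |b - a| :=
  hs.norm_image_sub_le_of_norm_hasDerivWithin_le (fun x hx => (hg x hx).hasDerivWithinAt) hK ha hb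

lemma taylor1 {g g' g'' : ℝ → ℝ} {s : Set ℝ} (hs : Convex ℝ s)
    (hg : ∀ x ∈ s, HasDerivAt g (g' x) x) (hg' : ∀ x ∈ s, HasDerivAt g' (g'' x) x)
    {K : ℝ} (hK : ∀ x ∈ s, |g'' x| ≤ K) {a b : ℝ} (ha : a ∈ s) (hb : b ∈ s) :
    |g b - g a - g' a * (b - a)| ≤ K * |b - a| ^ 2 := by
  have hK0 : 0 ≤ K := (abs_nonneg _).trans (hK a ha)
  have hsub : Set.uIcc a b ⊆ s := by
    rw [← segment_eq_uIcc]; exact hs.segment_subset ha hb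
  have := taylor0 (g := fun x => g x - g' a * (x - a)) (g' := fun x => g' x - g' a)
    (convex_uIcc a b) (K := K * |b - a|)
    (fun x hx => by
      have := (hg x (hsub hx)).sub (((hasDerivAt_id x).sub_const a).const_mul (g' a))
      rw [mul_one] at this
      exact this)
    (fun x hx => (taylor0 hs hg' hK ha (hsub hx)).trans
      (mul_le_mul_of_nonneg_left (Set.abs_sub_left_of_mem_uIcc hx) hK0))
    Set.left_mem_uIcc Set.right_mem_uIcc
  calc _ = |g b - g' a * (b - a) - (g a - g' a * (a - a))| := by congr 1; ring
    _ ≤ _ := this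
    _ = _ := by ring

lemma taylor2 {g g' g'' g3 : ℝ → ℝ} {s : Set ℝ} (hs : Convex ℝ s)
    (hg : ∀ x ∈ s, HasDerivAt g (g' x) x) (hg' : ∀ x ∈ s, HasDerivAt g' (g'' x) x)
    (hg'' : ∀ x ∈ s, HasDerivAt g'' (g3 x) x)
    {K : ℝ} (hK : ∀ x ∈ s, |g3 x| ≤ K) {a b : ℝ} (ha : a ∈ s) (hb : b ∈ s) :
    |g b - g a - g' a * (b - a) - g'' a * (b - a) ^ 2 / 2| ≤ K * |b - a| ^ 3 := by
  have hK0 : 0 ≤ K := (abs_nonneg _).trans (hK a ha)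
  have hsub : Set.uIcc a b ⊆ s := by
    rw [← segment_eq_uIcc]; exact hs.segment_subset ha hb
  have := taylor0 (g := fun x => g x - g' a * (x - a) - g'' a * (x - a) ^ 2 / 2)
    (g' := fun x => g' x - g' a - g'' a * (x - a))
    (convex_uIcc a b) (K := K * |b - a| ^ 2)
    (fun x hx => by
      have h0 := (hasDerivAt_id x).sub_const a
      have := ((hg x (hsub hx)).sub (h0.const_mul (g' a))).sub
        (((h0.pow 2).const_mul (g'' a)).div_const 2)
      exact this.congr_deriv (by simp; ring))
    (fun x hx => (taylor1 hs hg' hg'' hK ha (hsub hx)).trans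
      (mul_le_mul_of_nonneg_left
        (pow_le_pow_left₀ (abs_nonneg _) (Set.abs_sub_left_of_mem_uIcc hx) 2) hK0))
    Set.left_mem_uIcc Set.right_mem_uIcc
  calc _ = |g b - g' a * (b - a) - g'' a * (b - a) ^ 2 / 2
        - (g a - g' a * (a - a) - g'' a * (a - a) ^ 2 / 2)| := by congr 1; ring
    _ ≤ _ := this
    _ = _ := by ring

/-- Taylor expansion from a boundary point, by passing to the limit. -/
lemma taylor_bdry {g g' g'' : ℝ → ℝ} {s : Set ℝ} (hs : Convex ℝ s) [(nhdsWithin (0 : ℝ) s).NeBot]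
    (hg : ∀ x ∈ s, HasDerivAt g (g' x) x) (hg' : ∀ x ∈ s, HasDerivAt g' (g'' x) x)
    {K : ℝ} (hK : ∀ x ∈ s, |g'' x| ≤ K) {L D : ℝ}
    (hL : Tendsto g (nhdsWithin 0 s) (nhds L)) (hD : Tendsto g' (nhdsWithin 0 s) (nhds D))
    {b : ℝ} (hb : b ∈ s) :
    |g b - L - D * b| ≤ K * b ^ 2 := by
  have hid : Tendsto (fun a : ℝ => b - a) (nhdsWithin 0 s) (nhds (b - 0)) :=
    (tendsto_const_nhds.sub tendsto_id).mono_left nhdsWithin_le_nhds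
  have h1 : Tendsto (fun a => |g b - g a - g' a * (b - a)|) (nhdsWithin 0 s)
      (nhds |g b - L - D * (b - 0)|) := ((tendsto_const_nhds.sub hL).sub (hD.mul hid)).abs
  have h2 : Tendsto (fun a => K * |b - a| ^ 2) (nhdsWithin 0 s) (nhds (K * |b - 0| ^ 2)) :=
    (hid.abs.pow 2).const_mul K
  have := le_of_tendsto_of_tendsto h1 h2 (by
    filter_upwards [self_mem_nhdsWithin] with a ha using taylor1 hs hg hg' hK ha hb)
  simpa using this

lemma hasSum_tele (n : ℕ) (hn : 1 ≤ n) :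
    HasSum (fun k : ℕ => (n : ℝ) * (1 / ((n : ℝ) + k) - 1 / ((n : ℝ) + k + 1))) 1 := by
  have hn' : (1 : ℝ) ≤ n := by exact_mod_cast hn
  have key : HasSum (fun k : ℕ => (1 / ((n : ℝ) + k) - 1 / ((n : ℝ) + k + 1))) (1 / (n : ℝ)) := by
    rw [hasSum_iff_tendsto_nat_of_nonneg]
    · have h : ∀ N : ℕ, ∑ k ∈ Finset.range N, (1 / ((n : ℝ) + k) - 1 / ((n : ℝ) + k + 1))
          = 1 / (n : ℝ) - 1 / ((n : ℝ) + N) := by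
        intro N
        have := Finset.sum_range_sub' (fun k : ℕ => 1 / ((n : ℝ) + k)) N
        simpa [add_assoc] using this
      simp_rw [h]
      have : Tendsto (fun N : ℕ => 1 / ((n : ℝ) + N)) atTop (nhds 0) := by
        simp_rw [one_div]
        exact tendsto_inv_atTop_zero.comp
          (tendsto_atTop_add_const_left _ _ tendsto_natCast_atTop_atTop)
      simpa using (tendsto_const_nhds (x := 1 / (n : ℝ))).sub this
    · intro k
      rw [sub_nonneg]
      apply one_div_le_one_div_of_le <;> [positivity; linarith]
  have := key.mul_left (n : ℝ)
  rwa [mul_one_div_cancel (by positivity)] at this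

lemma int_sum_le {d : ℤ → ℝ} {G : ℕ → ℝ} {S : ℝ} (hd : ∀ x, 0 ≤ d x) (hG : HasSum G S)
    (h1 : ∀ k : ℕ, d k ≤ G k) (h2 : ∀ k : ℕ, d (-((k : ℤ) + 1)) ≤ G k) :
    Summable d ∧ ∑' x, d x ≤ 2 * S := by
  have s1 : Summable (fun k : ℕ => d k) := Summable.of_nonneg_of_le (fun _ => hd _) h1 hG.summable
  have s2 : Summable (fun k : ℕ => d (-((k : ℤ) + 1))) :=
    Summable.of_nonneg_of_le (fun _ => hd _) h2 hG.summable
  refine ⟨Summable.of_nat_of_neg_add_one s1 s2, ?_⟩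
  rw [tsum_of_nat_of_neg_add_one s1 s2]
  have e1 := s1.tsum_le_tsum h1 hG.summable
  have e2 := s2.tsum_le_tsum h2 hG.summable
  rw [hG.tsum_eq] at e1 e2
  linarith

lemma bulk {α : ℝ} {f : ℝ → ℝ} (hf : IsSAlpha α f) {s : Set ℝ} (hs : Convex ℝ s)
    (h0 : ∀ u ∈ s, u ≠ 0) {K : ℝ} (hK : ∀ u ∈ s, |iteratedDeriv 3 f u| ≤ K) {a h : ℝ} (hh : 0 ≤ h)
    (ha : a ∈ s) (h1 : a + h ∈ s) (h2 : a - h ∈ s) :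
    |f (a + h) - f a + (f (a - h) - f a) - h ^ 2 * iteratedDeriv 2 f a| ≤ 2 * K * h ^ 3 := by
  have d0 : ∀ x ∈ s, HasDerivAt f (iteratedDeriv 1 f x) x := fun x hx => by
    simpa using hasDerivAt_iter hf 0 (h0 x hx)
  have d1 : ∀ x ∈ s, HasDerivAt (iteratedDeriv 1 f) (iteratedDeriv 2 f x) x := fun x hx =>
    hasDerivAt_iter hf 1 (h0 x hx)
  have d2 : ∀ x ∈ s, HasDerivAt (iteratedDeriv 2 f) (iteratedDeriv 3 f x) x := fun x hx =>
    hasDerivAt_iter hf 2 (h0 x hx)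
  have t1 := taylor2 hs d0 d1 d2 hK ha h1
  have t2 := taylor2 hs d0 d1 d2 hK ha h2
  rw [show a + h - a = h by ring, abs_of_nonneg hh] at t1
  rw [show a - h - a = -h by ring, abs_neg, abs_of_nonneg hh] at t2
  rw [abs_le] at *
  constructor <;> linarith

lemma weight_le (n k : ℕ) (hn : 1 ≤ n) (j : ℝ) (hj : (k : ℝ) / 2 ≤ j) (M : ℝ) (hM : 0 ≤ M) :
    (n : ℝ) ^ 2 * (2 * (M / (1 + (j / n) ^ 2)) * (1 / (n : ℝ)) ^ 3) ≤
      32 * M * ((n : ℝ) * (1 / ((n : ℝ) + k) - 1 / ((n : ℝ) + k + 1))) := by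
  have hn' : (1 : ℝ) ≤ n := by exact_mod_cast hn
  have hk : (0 : ℝ) ≤ k := k.cast_nonneg
  have e1 : (n : ℝ) ^ 2 * (2 * (M / (1 + (j / n) ^ 2)) * (1 / (n : ℝ)) ^ 3)
      = M * n * (2 / (n ^ 2 + j ^ 2)) := by
    field_simp
  have e2 : 32 * M * ((n : ℝ) * (1 / ((n : ℝ) + k) - 1 / ((n : ℝ) + k + 1)))
      = M * n * (32 / (((n : ℝ) + k) * (n + k + 1))) := by
    field_simp
    ring
  rw [e1, e2]
  apply mul_le_mul_of_nonneg_left _ (by positivity)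
  rw [div_le_div_iff₀ (by positivity) (by positivity)]
  have : (k : ℝ) ^ 2 / 4 ≤ j ^ 2 := by nlinarith
  nlinarith [sq_nonneg ((n : ℝ) - k)]

/-- **Replacement of the discrete generator by `Δ_α`** (Lemma 5.1). For `f ∈ S_α(ℝ)`,
the total discrepancy `Σ_{x∈ℤ} |n²(𝒜_n f_n)(x) − (Δ_α f)(x/n)|` is bounded uniformly in
`n`; consequently, for any `η̄ : ℤ → [−2,2]`, the weighted sum divided by `√n` is `O(n^{-1/2})`. -/
theorem replacement_discrete_laplacian
    (α : ℝ) (hα : 0 < α) (f : ℝ → ℝ) (hf : IsSAlpha α f)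
    (L2 : ℝ) (hL2 : Filter.Tendsto (iteratedDeriv 2 f) (nhdsWithin 0 (Set.Ioi 0)) (nhds L2)) :
    ∃ C : ℝ, 0 < C ∧ ∀ n : ℕ, 1 ≤ n →
      (Summable (fun x : ℤ => |discrepancy α f L2 n x|) ∧
        (∑' x : ℤ, |discrepancy α f L2 n x|) ≤ C) ∧
      ∀ ηb : ℤ → ℝ, (∀ x : ℤ, |ηb x| ≤ 2) →
        |(∑' x : ℤ, discrepancy α f L2 n x * ηb x) / Real.sqrt n| ≤ C / Real.sqrt n := by
  obtain ⟨Lp, Lm, Dp, Dm, hLp, hLm, hDp, hDm, eDp, eDm⟩ := hf.robin 0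
  simp only [mul_zero, iteratedDeriv_zero, zero_add] at hLp hLm hDp hDm
  obtain rfl : Lm = f 0 := tendsto_nhds_unique hLm hf.left_cont
  obtain ⟨M2, hM2⟩ := hf.decay 2 0
  obtain ⟨M3, hM3⟩ := hf.decay 3 2
  have hM2' : ∀ u : ℝ, u ≠ 0 → |iteratedDeriv 2 f u| ≤ M2 := fun u hu => by
    have := hM2 u hu
    rw [pow_zero] at this
    linarith [abs_nonneg (iteratedDeriv 2 f u)]
  have hM20 : 0 ≤ M2 := (abs_nonneg _).trans (hM2' 1 one_ne_zero)
  have hM30 : 0 ≤ M3 := le_trans (by positivity) (hM3 1 one_ne_zero)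
  have hM3' : ∀ u r : ℝ, 0 ≤ r → u ≠ 0 → r ≤ |u| → |iteratedDeriv 3 f u| ≤ M3 / (1 + r ^ 2) := by
    intro u r hr hu hru
    rw [le_div_iff₀ (by positivity)]
    refine le_trans ?_ (hM3 u hu)
    rw [mul_comm]
    gcongr
  have d0 : ∀ x : ℝ, x ≠ 0 → HasDerivAt f (iteratedDeriv 1 f x) x := fun x hx => by
    simpa using hasDerivAt_iter hf 0 hx
  have d1 : ∀ x : ℝ, x ≠ 0 → HasDerivAt (iteratedDeriv 1 f) (iteratedDeriv 2 f x) x :=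
    fun x hx => hasDerivAt_iter hf 1 hx
  have tp : ∀ b : ℝ, 0 < b → |f b - Lp - Dp * b| ≤ M2 * b ^ 2 := fun b hb =>
    taylor_bdry (s := Set.Ioi 0) (convex_Ioi 0) (fun x hx => d0 x (ne_of_gt hx))
      (fun x hx => d1 x (ne_of_gt hx)) (fun x hx => hM2' x (ne_of_gt hx)) hLp hDp hb
  have tm : ∀ b : ℝ, b < 0 → |f b - f 0 - Dm * b| ≤ M2 * b ^ 2 := fun b hb =>
    taylor_bdry (s := Set.Iio 0) (convex_Iio 0) (fun x hx => d0 x (ne_of_lt hx))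
      (fun x hx => d1 x (ne_of_lt hx)) (fun x hx => hM2' x (ne_of_lt hx)) hLm hDm hb
  obtain ⟨D, rfl⟩ : ∃ D, Dp = D := ⟨_, rfl⟩
  obtain rfl : Dm = Dp := by rw [eDm, eDp]
  set B : ℝ := α * |Dm| + α * M2 + 7 * M2 + |L2| with hB
  have hB0 : 0 ≤ B := by positivity
  have hbd : ∀ n : ℕ, 1 ≤ n → ∀ x : ℤ, |x| ≤ 1 → |discrepancy α f L2 n x| ≤ B := by
    intro n hn x hx
    have hn' : (0 : ℝ) < n := by exact_mod_cast hn
    have hn1 : (1 : ℝ) ≤ n := by exact_mod_cast hn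
    have scale : ∀ (E c : ℝ), |E| ≤ M2 * c → |(n : ℝ) ^ 2 * E| ≤ M2 * (n ^ 2 * c) := by
      intro E c hE
      rw [abs_mul, abs_of_nonneg (by positivity : (0 : ℝ) ≤ (n : ℝ) ^ 2)]
      nlinarith [mul_le_mul_of_nonneg_left hE (by positivity : (0 : ℝ) ≤ (n : ℝ) ^ 2)]
    have p1 := scale _ _ (tp (1 / n) (by positivity))
    have p2 := scale _ _ (tp (2 / n) (by positivity))
    have m1 := scale _ _ (tm (-1 / n) (div_neg_of_neg_of_pos (by norm_num) hn'))
    have m2 := scale _ _ (tm (-2 / n) (div_neg_of_neg_of_pos (by norm_num) hn'))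
    have c1 : (n : ℝ) ^ 2 * (1 / n) ^ 2 = 1 := by field_simp
    have c2 : (n : ℝ) ^ 2 * (2 / n) ^ 2 = 4 := by field_simp; try norm_num
    have c3 : (n : ℝ) ^ 2 * (-1 / n) ^ 2 = 1 := by field_simp; try norm_num
    have c4 : (n : ℝ) ^ 2 * (-2 / n) ^ 2 = 4 := by field_simp; try norm_num
    rw [c1] at p1
    rw [c2] at p2
    rw [c3] at m1
    rw [c4] at m2
    have p1' : |α * n * (f (1 / n) - Lp - Dm * (1 / n))| ≤ α * M2 := by
      have := tp (1 / n) (by positivity)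
      rw [abs_mul, abs_of_nonneg (by positivity : 0 ≤ α * (n : ℝ))]
      calc α * n * |f (1 / n) - Lp - Dm * (1 / n)| ≤ α * n * (M2 * (1 / n) ^ 2) := by gcongr
        _ = α * M2 * (1 / n) := by field_simp
        _ ≤ α * M2 * 1 := by
          gcongr
          rw [div_le_one hn']; exact hn1
        _ = α * M2 := mul_one _
    have aD : |α * Dm| ≤ α * |Dm| := by rw [abs_mul, abs_of_pos hα]
    have q1 := hM2' (1 / n) (by positivity)
    have q2 := hM2' (-1 / n) (ne_of_lt (div_neg_of_neg_of_pos (by norm_num) hn'))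
    have hxx : x = -1 ∨ x = 0 ∨ x = 1 := by rw [abs_le] at hx; omega
    have aL := abs_nonneg L2
    have aD0 : 0 ≤ α * |Dm| := by positivity
    have aM0 : 0 ≤ α * M2 := by positivity
    rcases hxx with rfl | rfl | rfl
    · have e : discrepancy α f L2 n (-1) =
          (n : ℝ) ^ 2 * (f (-2 / n) - f 0 - Dm * (-2 / n))
          - 2 * ((n : ℝ) ^ 2 * (f (-1 / n) - f 0 - Dm * (-1 / n)))
          - iteratedDeriv 2 f (-1 / n) := by
        norm_num [discrepancy, slowGen, xi]
        ring
      rw [e, hB]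
      rw [abs_le] at *
      constructor <;> linarith
    · have e : discrepancy α f L2 n 0 =
          α * Dm + α * n * (f (1 / n) - Lp - Dm * (1 / n))
          + (n : ℝ) ^ 2 * (f (-1 / n) - f 0 - Dm * (-1 / n)) - L2 := by
        norm_num [discrepancy, slowGen, xi]
        field_simp
        rw [eDp]
        ring
      have aL1 := le_abs_self L2
      have aL2 := neg_abs_le L2
      rw [e, hB]
      rw [abs_le] at aD p1' m1 ⊢
      constructor <;> linarith
    · have e : discrepancy α f L2 n 1 =
          (n : ℝ) ^ 2 * (f (2 / n) - Lp - Dm * (2 / n))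
          - (n : ℝ) ^ 2 * (f (1 / n) - Lp - Dm * (1 / n))
          - α * Dm - α * n * (f (1 / n) - Lp - Dm * (1 / n))
          - iteratedDeriv 2 f (1 / n) := by
        norm_num [discrepancy, slowGen, xi]
        field_simp
        rw [eDp]
        ring
      rw [e, hB]
      rw [abs_le] at aD p1' p1 p2 q1 ⊢
      constructor <;> linarith
  have hbulk : ∀ n : ℕ, 1 ≤ n → ∀ (x : ℤ) (k : ℕ), 2 ≤ |x| → (k : ℤ) ≤ |x| →
      |discrepancy α f L2 n x| ≤
        32 * M3 * ((n : ℝ) * (1 / ((n : ℝ) + k) - 1 / ((n : ℝ) + k + 1))) := by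
    intro n hn x k hx hk
    have hn' : (0 : ℝ) < n := by exact_mod_cast hn
    have hx0 : x ≠ 0 := by rintro rfl; simp at hx
    have hx1 : x - 1 ≠ 0 := by
      intro h
      obtain rfl : x = 1 := by omega
      simp at hx
    have hxr : (2 : ℝ) ≤ |(x : ℝ)| := by exact_mod_cast hx
    have hkr : (k : ℝ) ≤ |(x : ℝ)| := by exact_mod_cast hk
    have e : discrepancy α f L2 n x = (n : ℝ) ^ 2 *
        (f ((x : ℝ) / n + 1 / n) - f ((x : ℝ) / n) + (f ((x : ℝ) / n - 1 / n) - f ((x : ℝ) / n))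
          - (1 / (n : ℝ)) ^ 2 * iteratedDeriv 2 f ((x : ℝ) / n)) := by
      simp only [discrepancy, slowGen, xi, if_neg hx0, if_neg hx1, one_mul]
      push_cast
      rw [add_div, sub_div]
      field_simp
    have hr : ∀ u ∈ Set.Icc ((x : ℝ) / n - 1 / n) ((x : ℝ) / n + 1 / n),
        (|(x : ℝ)| - 1) / n ≤ |u| := by
      intro u hu
      have h1 : |(x : ℝ) / n - u| ≤ 1 / n := by
        rw [abs_le]; constructor <;> linarith [hu.1, hu.2]
      have h2 := abs_sub_abs_le_abs_sub ((x : ℝ) / n) u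
      rw [abs_div, abs_of_pos hn'] at h2
      rw [sub_div]
      linarith
    have hpos : 0 < (|(x : ℝ)| - 1) / n := div_pos (by linarith) hn'
    have h0 : ∀ u ∈ Set.Icc ((x : ℝ) / n - 1 / n) ((x : ℝ) / n + 1 / n), u ≠ 0 :=
      fun u hu => abs_pos.1 (hpos.trans_le (hr u hu))
    have hinv : (0 : ℝ) ≤ 1 / n := by positivity
    have hb := bulk hf (convex_Icc _ _) h0
      (fun u hu => hM3' u _ hpos.le (h0 u hu) (hr u hu)) (a := (x : ℝ) / n) (h := 1 / n) hinv
      ⟨by linarith, by linarith⟩ ⟨by linarith, le_rfl⟩ ⟨le_rfl, by linarith⟩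
    rw [e, abs_mul, abs_of_nonneg (by positivity : (0 : ℝ) ≤ (n : ℝ) ^ 2)]
    exact (mul_le_mul_of_nonneg_left hb (by positivity)).trans
      (weight_le n k hn _ (by linarith) M3 hM30)
  set S : ℝ := 2 * (2 * B + 32 * M3) with hS
  have main : ∀ n : ℕ, 1 ≤ n → Summable (fun x : ℤ => |discrepancy α f L2 n x|) ∧
        (∑' x : ℤ, |discrepancy α f L2 n x|) ≤ S := by
    intro n hn
    have g1 : HasSum (fun k : ℕ => if k < 2 then B else 0) (2 * B) := by
      have := hasSum_sum_of_ne_finset_zero (L := SummationFilter.unconditional ℕ) (f := fun k : ℕ => if k < 2 then B else 0)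
        (s := Finset.range 2) (fun b hb => by
          rw [Finset.mem_range] at hb
          exact if_neg hb)
      simpa [Finset.sum_range_succ, two_mul] using this
    have g2 := (hasSum_tele n hn).mul_left (32 * M3)
    rw [mul_one] at g2
    have hT : ∀ k : ℕ, 0 ≤ 32 * M3 *
        ((n : ℝ) * (1 / ((n : ℝ) + k) - 1 / ((n : ℝ) + k + 1))) := by
      intro k
      have hn' : (1 : ℝ) ≤ n := by exact_mod_cast hn
      have : 0 ≤ 1 / ((n : ℝ) + k) - 1 / ((n : ℝ) + k + 1) := by
        rw [sub_nonneg]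
        apply one_div_le_one_div_of_le <;> [positivity; linarith]
      positivity
    have gen : ∀ (x : ℤ) (k : ℕ), (k : ℤ) ≤ |x| → |x| ≤ k + 1 → |discrepancy α f L2 n x| ≤
        (if k < 2 then B else 0) + 32 * M3 *
        ((n : ℝ) * (1 / ((n : ℝ) + k) - 1 / ((n : ℝ) + k + 1))) := by
      intro x k hk hk'
      by_cases hx : |x| ≤ 1
      · rw [if_pos (by omega)]
        linarith [hbd n hn x hx, hT k]
      · have h1 := hbulk n hn x k (by omega) hk
        have h2 : 0 ≤ (if k < 2 then B else 0) := by split_ifs <;> simp [hB0]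
        linarith
    exact int_sum_le (fun _ => abs_nonneg _) (g1.add g2)
      (fun k => gen k k (by simp) (by simp))
      (fun k => gen _ k (by rw [abs_neg, abs_of_nonneg (by positivity)]; simp)
        (by rw [abs_neg, abs_of_nonneg (by positivity)]))
  have hS0 : 0 ≤ S := by positivity
  refine ⟨2 * S + 1, by linarith, fun n hn => ?_⟩
  obtain ⟨hs, hle⟩ := main n hn
  refine ⟨⟨hs, by linarith⟩, fun ηb hη => ?_⟩
  rw [abs_div, abs_of_nonneg (Real.sqrt_nonneg _)]
  apply div_le_div_of_nonneg_right _ (Real.sqrt_nonneg _)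
  have hp : ∀ x, |discrepancy α f L2 n x * ηb x| ≤ |discrepancy α f L2 n x| * 2 := fun x => by
    rw [abs_mul]
    exact mul_le_mul_of_nonneg_left (hη x) (abs_nonneg _)
  have := tsum_of_norm_bounded (f := fun x => discrepancy α f L2 n x * ηb x) (hs.hasSum.mul_right 2) hp
  rw [Real.norm_eq_abs] at this
  linarith
end
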